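/- arXiv:0708.1813 — 7 statements merged into one kernel-verified Lean document; each statement's English description precedes it below -/
import Mathlib

section
/- Let A be an m × m column-stochastic matrix (all entries nonnegative and each column sums to 1), so that x ↦ Ax maps the simplex S^{m-1} into itself. If Ax ≻ x for every x ∈ S^{m-1}, then for every i the vector Ae_i is a vertex of the simplex, i.e., each column of A has exactly one entry equal to 1 and all other entries equal to 0. -/
open Finset Filter Topology

/-- Membership in the simplex `S^{m-1}`. -/
def InSimplex {m : ℕ} (x : Fin m → ℝ) : Prop :=
  (∀ i, 0 ≤ x i) ∧ ∑ i, x i = 1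

/-- The decreasing rearrangement `x↓` of a vector. -/
noncomputable def dsort {m : ℕ} (x : Fin m → ℝ) : Fin m → ℝ :=
  fun i => x (Tuple.sort x i.rev)

/-- The sum of the `k` largest coordinates of `x`. -/
noncomputable def topSum {m : ℕ} (x : Fin m → ℝ) (k : ℕ) : ℝ :=
  ∑ i ∈ Finset.univ.filter (fun i : Fin m => (i : ℕ) < k), dsort x i

/-- `Maj x y` means `x ≺ y` : `x` is majorized by `y`. -/
def Maj {m : ℕ} (x y : Fin m → ℝ) : Prop :=
  (∀ k, 1 ≤ k → k ≤ m - 1 → topSum x k ≤ topSum y k) ∧ ∑ i, x i = ∑ i, y i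

/-- The `k`-th vertex of the simplex. -/
def vertex {m : ℕ} (k : Fin m) : Fin m → ℝ := fun i => if i = k then 1 else 0

/-- The quadratic stochastic operator associated to coefficients `p`. -/
def qso {m : ℕ} (p : Fin m → Fin m → Fin m → ℝ) (x : Fin m → ℝ) : Fin m → ℝ :=
  fun k => ∑ i, ∑ j, p i j k * x i * x j

/-- Conditions on the heredity coefficients of a q.s.o. -/
def IsQSO {m : ℕ} (p : Fin m → Fin m → Fin m → ℝ) : Prop :=
  (∀ i j k, 0 ≤ p i j k) ∧ (∀ i j k, p i j k = p j i k) ∧ (∀ i j, ∑ k, p i j k = 1)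

theorem topSum_one {n : ℕ} (x : Fin (n + 1) → ℝ) : topSum x 1 = dsort x 0 := by
  have h : Finset.univ.filter (fun i : Fin (n + 1) => (i : ℕ) < 1) = {0} := by
    ext i
    simp
  rw [topSum, h, Finset.sum_singleton]

theorem le_dsort_zero {n : ℕ} (x : Fin (n + 1) → ℝ) (j : Fin (n + 1)) : x j ≤ dsort x 0 := by
  have h : (x ∘ Tuple.sort x) ((Tuple.sort x).symm j) ≤ (x ∘ Tuple.sort x) (Fin.rev 0) :=
    Tuple.monotone_sort x (by rw [Fin.rev_zero]; exact Fin.le_last _)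
  simpa [dsort] using h

/-- A nonnegative vector of total mass one with an entry at least one is a vertex. -/
theorem eq_one_and_eq_zero_of_one_le {m : ℕ} {y : Fin m → ℝ} (hy : InSimplex y) {i : Fin m}
    (hi : 1 ≤ y i) : y i = 1 ∧ ∀ i', i' ≠ i → y i' = 0 := by
  obtain ⟨hnn, hsum⟩ := hy
  rw [← Finset.add_sum_erase _ _ (Finset.mem_univ i)] at hsum
  have hrest : 0 ≤ ∑ k ∈ Finset.univ.erase i, y k := Finset.sum_nonneg fun k _ => hnn k
  refine ⟨by linarith, fun i' hne => ?_⟩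
  have hle : y i' ≤ ∑ k ∈ Finset.univ.erase i, y k :=
    Finset.single_le_sum (fun k _ => hnn k) (Finset.mem_erase.2 ⟨hne, Finset.mem_univ i'⟩)
  linarith [hnn i']

theorem stmt1 (m : ℕ) (A : Matrix (Fin m) (Fin m) ℝ)
    (hnn : ∀ i j, 0 ≤ A i j) (hcol : ∀ j, ∑ i, A i j = 1)
    (hdiss : ∀ x : Fin m → ℝ, InSimplex x → Maj x (A.mulVec x)) :
    ∀ j, ∃ i, A i j = 1 ∧ ∀ i', i' ≠ i → A i' j = 0 := by
  intro j
  have hA : InSimplex (fun i => A i j) := ⟨fun i => hnn i j, hcol j⟩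
  suffices h : ∃ i, 1 ≤ A i j from
    h.imp fun i hi => eq_one_and_eq_zero_of_one_le hA hi
  match m with
  | 0 => exact j.elim0
  | 1 => exact ⟨0, by simpa using (hcol j).ge⟩
  | n + 2 =>
    have hx : InSimplex (Pi.single j (1 : ℝ)) :=
      ⟨fun i => by by_cases h : i = j <;> simp [h], by simp⟩
    have h := (hdiss _ hx).1 1 le_rfl (by omega)
    rw [topSum_one, topSum_one, Matrix.mulVec_single_one] at h
    have hj := le_dsort_zero (Pi.single j (1 : ℝ)) j
    rw [Pi.single_eq_same] at hj
    exact ⟨_, hj.trans h⟩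
end

section
/- Let V be a dissipative quadratic stochastic operator on S^{m-1} with coefficients p_{ij,k}, and suppose p_{jj,k_0} = 1 for some indices j and k_0. Then p_{ij,k_0} ≥ 1/2 for every i = 1, …, m, and p_{ij,k_0} is the largest coordinate of the vector a_{ij} = (p_{ij,1}, …, p_{ij,m}). -/
open Finset Filter Topology

theorem le_topSum_one {m : ℕ} (x : Fin m → ℝ) (i : Fin m) : x i ≤ topSum x 1 := by
  obtain _ | n := m
  · exact i.elim0
  rw [topSum_one, dsort, Fin.rev_zero]
  have hi := Tuple.monotone_sort x (Fin.le_last ((Tuple.sort x).symm i))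
  simpa using hi

theorem exists_topSum_one_eq {m : ℕ} (x : Fin m → ℝ) (hm : 0 < m) : ∃ t, topSum x 1 = x t := by
  obtain _ | n := m
  · exact absurd hm (lt_irrefl 0)
  exact ⟨_, topSum_one x⟩

theorem inSimplex_segment {m : ℕ} (i j : Fin m) {e : ℝ} (h0 : 0 ≤ e) (h1 : e ≤ 1) :
    InSimplex (fun l => (1 - e) * vertex j l + e * vertex i l) := by
  refine ⟨fun l => ?_, ?_⟩
  · have h2 : 0 ≤ 1 - e := by linarith
    simp only [vertex]
    split_ifs <;> positivity
  · simp [vertex, Finset.sum_add_distrib]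

theorem qso_segment {m : ℕ} {p : Fin m → Fin m → Fin m → ℝ} (hp : IsQSO p) (i j k : Fin m)
    (e : ℝ) :
    qso p (fun l => (1 - e) * vertex j l + e * vertex i l) k =
      (1 - e) ^ 2 * p j j k + 2 * e * (1 - e) * p i j k + e ^ 2 * p i i k := by
  simp only [qso, vertex, mul_add, add_mul, Finset.sum_add_distrib, mul_ite, ite_mul, mul_zero,
    zero_mul, mul_one, Finset.sum_ite_eq', Finset.mem_univ, if_true]
  rw [hp.2.1 j i k]
  ring

theorem IsQSO.add_le_one {m : ℕ} {p : Fin m → Fin m → Fin m → ℝ} (hp : IsQSO p) (i j : Fin m)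
    {s t : Fin m} (hst : s ≠ t) : p i j s + p i j t ≤ 1 := by
  rw [← hp.2.2 i j, ← Finset.sum_pair hst]
  exact Finset.sum_le_sum_of_subset_of_nonneg (Finset.subset_univ _) fun k _ _ => hp.1 i j k

theorem IsQSO.le_one {m : ℕ} {p : Fin m → Fin m → Fin m → ℝ} (hp : IsQSO p) (i j k : Fin m) :
    p i j k ≤ 1 := by
  rw [← hp.2.2 i j]
  exact Finset.single_le_sum (fun k _ => hp.1 i j k) (Finset.mem_univ k)

theorem half_le_of_dissipative {m : ℕ} {p : Fin m → Fin m → Fin m → ℝ} (hp : IsQSO p)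
    (hdiss : ∀ x, InSimplex x → Maj x (qso p x)) {j k0 : Fin m} (hjj : p j j k0 = 1)
    {i : Fin m} (hij : i ≠ j) : 1 / 2 ≤ p i j k0 := by
  by_contra! ha
  have hm : 1 ≤ m - 1 := by
    have := Fin.val_ne_of_ne hij
    omega
  have ha0 := hp.1 i j k0
  obtain ⟨e, he⟩ : ∃ e, e = (1 - 2 * p i j k0) / 8 := ⟨_, rfl⟩
  have he0 : 0 < e := by linarith
  have he1 : e ≤ 1 / 8 := by linarith
  have hmaj := (hdiss _ (inSimplex_segment i j he0.le (by linarith))).1 1 le_rfl hm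
  have hxj := le_topSum_one (fun l => (1 - e) * vertex j l + e * vertex i l) j
  obtain ⟨t, ht⟩ := exists_topSum_one_eq
    (qso p (fun l => (1 - e) * vertex j l + e * vertex i l)) (by omega)
  rw [ht, qso_segment hp] at hmaj
  simp only [vertex, if_true, if_neg hij.symm, mul_one, mul_zero, add_zero] at hxj hmaj
  have hb := mul_le_mul_of_nonneg_left (hp.le_one i i t) (sq_nonneg e)
  by_cases htk : t = k0
  · subst htk
    rw [hjj] at hmaj
    have hak : p i j t = (1 - 8 * e) / 2 := by linarith
    rw [hak] at hmaj
    nlinarith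
  · have hjt : p j j t = 0 := by
      have := hp.add_le_one j j htk
      linarith [hp.1 j j t]
    have hc := mul_le_mul_of_nonneg_left (hp.le_one i j t)
      (show 0 ≤ 2 * e * (1 - e) from mul_nonneg (by linarith) (by linarith))
    rw [hjt] at hmaj
    nlinarith

theorem stmt4 (m : ℕ) (p : Fin m → Fin m → Fin m → ℝ) (hp : IsQSO p)
    (hdiss : ∀ x, InSimplex x → Maj x (qso p x))
    (j k0 : Fin m) (hjj : p j j k0 = 1) :
    ∀ i, (1 : ℝ) / 2 ≤ p i j k0 ∧ ∀ t, p i j t ≤ p i j k0 := by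
  intro i
  have hhalf : (1 : ℝ) / 2 ≤ p i j k0 := by
    by_cases hij : i = j
    · subst hij
      rw [hjj]
      norm_num
    · exact half_le_of_dissipative hp hdiss hjj hij
  refine ⟨hhalf, fun t => ?_⟩
  by_cases htk : t = k0
  · rw [htk]
  · have := hp.add_le_one i j htk
    linarith
end

section
/- Let m ≥ 3 and let V be a dissipative quadratic stochastic operator on S^{m-1} with coefficients p_{ij,k}, and suppose p_{jj,k_0} = 1 for some indices j and k_0. Then for every i = 1, …, m the vector a_{ij} = (p_{ij,1}, …, p_{ij,m}) has at most two nonzero coordinates: there exists k* ≠ k_0 with p_{ij,k_0} + p_{ij,k*} = 1 and p_{ij,t} = 0 for all t ∉ {k_0, k*}. -/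
open Finset Filter Topology

lemma topSum_two {m : ℕ} (hm : 1 < m) (x : Fin m → ℝ) :
    topSum x 2 = dsort x ⟨0, by omega⟩ + dsort x ⟨1, hm⟩ := by
  have h : (Finset.univ.filter fun i : Fin m => (i : ℕ) < 2) = {⟨0, by omega⟩, ⟨1, hm⟩} := by
    ext i
    simp only [mem_filter, Finset.mem_univ, true_and, Finset.mem_insert, Finset.mem_singleton,
      Fin.ext_iff]
    omega
  rw [topSum, h, Finset.sum_pair (by simp)]

lemma exists_topSum_two {m : ℕ} (hm : 1 < m) (x : Fin m → ℝ) :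
    ∃ a b, a ≠ b ∧ topSum x 2 = x a + x b :=
  ⟨_, _, fun h => by simp at h, topSum_two hm x⟩

lemma dsort_antitone {m : ℕ} (x : Fin m → ℝ) : Antitone (dsort x) := fun _ _ h =>
  Tuple.monotone_sort x (Fin.rev_le_rev.mpr h)

lemma exists_dsort_eq {m : ℕ} (x : Fin m → ℝ) (t : Fin m) :
    ∃ q, Tuple.sort x q.rev = t ∧ dsort x q = x t :=
  ⟨((Tuple.sort x).symm t).rev, by simp, by simp [dsort]⟩

lemma two_mul_le_topSum_two {m : ℕ} (hm : 1 < m) (x : Fin m → ℝ) {i j : Fin m} (hij : i ≠ j)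
    {c : ℝ} (hi : c ≤ x i) (hj : c ≤ x j) : 2 * c ≤ topSum x 2 := by
  have key : ∃ q : Fin m, 1 ≤ (q : ℕ) ∧ c ≤ dsort x q := by
    obtain ⟨q, hq, hqi⟩ := exists_dsort_eq x i
    obtain ⟨r, hr, hrj⟩ := exists_dsort_eq x j
    by_cases h : 1 ≤ (q : ℕ)
    · exact ⟨q, h, hqi ▸ hi⟩
    · refine ⟨r, ?_, hrj ▸ hj⟩
      by_contra h'
      have : q = r := Fin.ext (by omega)
      exact hij (by rw [← hq, ← hr, this])
  obtain ⟨q, hq, hc⟩ := key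
  have h1 : dsort x q ≤ dsort x ⟨1, hm⟩ := dsort_antitone x hq
  have h0 : dsort x ⟨1, hm⟩ ≤ dsort x ⟨0, by omega⟩ := dsort_antitone x (Nat.zero_le 1)
  rw [topSum_two hm]
  linarith

lemma mul_le_qso {m : ℕ} {p : Fin m → Fin m → Fin m → ℝ} (hp : ∀ i j k, 0 ≤ p i j k)
    {x : Fin m → ℝ} (hx : ∀ i, 0 ≤ x i) (i j k : Fin m) : p i j k * x i * x j ≤ qso p x k := by
  have hnn : ∀ a b, 0 ≤ p a b k * x a * x b := fun a b =>
    mul_nonneg (mul_nonneg (hp a b k) (hx a)) (hx b)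
  calc p i j k * x i * x j ≤ ∑ b, p i b k * x i * x b :=
        Finset.single_le_sum (f := fun b => p i b k * x i * x b) (fun b _ => hnn i b)
          (Finset.mem_univ j)
    _ ≤ qso p x k :=
        Finset.single_le_sum (f := fun a => ∑ b, p a b k * x a * x b)
          (fun a _ => Finset.sum_nonneg fun b _ => hnn a b) (Finset.mem_univ i)

/-- At the midpoint of the edge joining two vertices, the image under a dissipative operator is
supported on two coordinates. -/
lemma exists_support_pair {m : ℕ} (hm : 3 ≤ m) {p : Fin m → Fin m → Fin m → ℝ} (hp : IsQSO p)
    (hdiss : ∀ x, InSimplex x → Maj x (qso p x)) {i j : Fin m} (hij : i ≠ j) :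
    ∃ a b, a ≠ b ∧ ∀ t, t ≠ a → t ≠ b → p i j t = 0 ∧ p j j t = 0 := by
  set x : Fin m → ℝ := fun t => if t = i ∨ t = j then 1 / 2 else 0 with hx
  have hxi : x i = 1 / 2 := by simp [hx]
  have hxj : x j = 1 / 2 := by simp [hx]
  have hx0 : ∀ t, 0 ≤ x t := fun t => by simp only [hx]; split_ifs <;> norm_num
  have hx1 : ∑ t, x t = 1 := by
    rw [Fintype.sum_eq_add i j hij fun t ht => by simp [hx, ht.1, ht.2], hxi, hxj]
    norm_num
  obtain ⟨htop, hsum⟩ := hdiss x ⟨hx0, hx1⟩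
  have h2 := (two_mul_le_topSum_two (by omega) x hij hxi.ge hxj.ge).trans
    (htop 2 (by norm_num) (by omega))
  obtain ⟨a, b, hab, hy⟩ := exists_topSum_two (by omega) (qso p x)
  have hy0 : ∀ t, 0 ≤ qso p x t := fun t =>
    (mul_nonneg (mul_nonneg (hp.1 i i t) (hx0 i)) (hx0 i)).trans (mul_le_qso hp.1 hx0 i i t)
  refine ⟨a, b, hab, fun t hta htb => ?_⟩
  have hle : ∑ s ∈ {t, a, b}, qso p x s ≤ ∑ s, qso p x s :=
    Finset.sum_le_univ_sum_of_nonneg hy0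
  rw [Finset.sum_insert (by simp [hta, htb]), Finset.sum_pair hab] at hle
  have h_ij := mul_le_qso hp.1 hx0 i j t
  have h_jj := mul_le_qso hp.1 hx0 j j t
  rw [hxi, hxj] at h_ij
  rw [hxj] at h_jj
  have := hp.1 i j t
  have := hp.1 j j t
  constructor <;> linarith

theorem stmt5 (m : ℕ) (hm : 3 ≤ m) (p : Fin m → Fin m → Fin m → ℝ) (hp : IsQSO p)
    (hdiss : ∀ x, InSimplex x → Maj x (qso p x))
    (j k0 : Fin m) (hjj : p j j k0 = 1) :
    ∀ i, ∃ k, k ≠ k0 ∧ p i j k0 + p i j k = 1 ∧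
      ∀ t, t ≠ k0 → t ≠ k → p i j t = 0 := by
  intro i
  suffices h : ∃ k, k ≠ k0 ∧ ∀ t, t ≠ k0 → t ≠ k → p i j t = 0 by
    obtain ⟨k, hk, h⟩ := h
    refine ⟨k, hk, ?_, h⟩
    rw [← hp.2.2 i j, Fintype.sum_eq_add k0 k hk.symm fun t ht => h t ht.1 ht.2]
  by_cases hij : i = j
  · subst hij
    have : Nontrivial (Fin m) := Fin.nontrivial_iff_two_le.mpr (by omega)
    obtain ⟨k, hk⟩ := exists_ne k0
    refine ⟨k, hk, fun t ht _ => ?_⟩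
    have hle : ∑ s ∈ {t, k0}, p i i s ≤ ∑ s, p i i s :=
      Finset.sum_le_univ_sum_of_nonneg (hp.1 i i)
    rw [Finset.sum_pair ht, hp.2.2] at hle
    linarith [hp.1 i i t]
  · obtain ⟨a, b, hab, h⟩ := exists_support_pair hm hp hdiss hij
    by_cases ha : k0 = a
    · subst ha
      exact ⟨b, hab.symm, fun t h1 h2 => (h t h1 h2).1⟩
    by_cases hb : k0 = b
    · subst hb
      exact ⟨a, hab, fun t h1 h2 => (h t h2 h1).1⟩
    · linarith [(h k0 ha hb).2]
end

section
/- Let V be a quadratic stochastic operator on S^{m-1} of the form (Vx)_1 = ∑_{i=1}^m x_i² + 2∑_{i<j} p_{ij,1} x_ix_j and (Vx)_k = 2∑_{i<j} p_{ij,k} x_ix_j for 2 ≤ k ≤ m, where p_{ij,1} ≥ 1/2 for all i < j. Then the vertex e_1 is the unique fixed point of V in S^{m-1}. -/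
open Finset Filter Topology

/-- The square of a finite sum splits into the squares and twice the off-diagonal products. -/
theorem sq_sum_eq_sum_sq_add_two_mul {ι : Type*} [Fintype ι] [LinearOrder ι] (x : ι → ℝ) :
    (∑ i, x i) ^ 2 =
      ∑ i, x i ^ 2 + 2 * ∑ i, ∑ j ∈ Finset.univ.filter (fun j => i < j), x i * x j := by
  have split : ∀ i j, x i * x j =
      (if i = j then x i * x j else 0) + (if i < j then x i * x j else 0) +
        (if j < i then x i * x j else 0) := by
    intro i j
    rcases lt_trichotomy i j with h | h | h
    · simp [h, h.ne, h.not_gt]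
    · simp [h]
    · simp [h, h.ne', h.not_gt]
  have swap : ∑ i, ∑ j, (if j < i then x i * x j else 0) =
      ∑ i, ∑ j, (if i < j then x i * x j else 0) := by
    rw [Finset.sum_comm]
    simp only [mul_comm]
  have diag : ∑ i, ∑ j, (if i = j then x i * x j else 0) = ∑ i, x i ^ 2 := by
    simp [sq]
  simp only [Finset.sum_filter]
  rw [sq, Finset.sum_mul_sum, Finset.sum_congr rfl fun i _ =>
    Finset.sum_congr rfl fun j _ => split i j]
  simp only [Finset.sum_add_distrib]
  rw [swap, diag]
  ring

theorem stmt7 (m : ℕ) (hm : 0 < m) (p : Fin m → Fin m → Fin m → ℝ)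
    (hnn : ∀ i j k, 0 ≤ p i j k)
    (hsum : ∀ i j : Fin m, i < j → ∑ k, p i j k = 1)
    (hhalf : ∀ i j : Fin m, i < j → (1 : ℝ) / 2 ≤ p i j ⟨0, hm⟩)
    (V : (Fin m → ℝ) → Fin m → ℝ)
    (hV : ∀ x k, V x k =
      (if k = (⟨0, hm⟩ : Fin m) then ∑ i, x i ^ 2 else 0) +
        2 * ∑ i, ∑ j ∈ Finset.univ.filter (fun j => i < j), p i j k * x i * x j) :
    (InSimplex (vertex (⟨0, hm⟩ : Fin m)) ∧ V (vertex ⟨0, hm⟩) = vertex ⟨0, hm⟩) ∧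
      ∀ x, InSimplex x → V x = x → x = vertex ⟨0, hm⟩ := by
  set z : Fin m := ⟨0, hm⟩
  have hcross : ∀ k, ∑ i, ∑ j ∈ Finset.univ.filter (fun j => i < j),
      p i j k * vertex z i * vertex z j = 0 := by
    intro k
    refine Finset.sum_eq_zero fun i _ => Finset.sum_eq_zero fun j hj => ?_
    have hj : j ≠ z := by
      rintro rfl
      exact absurd (Fin.lt_def.mp (Finset.mem_filter.mp hj).2) (Nat.not_lt_zero _)
    simp [vertex, hj]
  refine ⟨⟨⟨fun i => ?_, ?_⟩, ?_⟩, ?_⟩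
  · unfold vertex
    split_ifs <;> norm_num
  · simp [vertex]
  · funext k
    rw [hV, hcross]
    simp [vertex]
  · rintro x ⟨hx, hx1⟩ hfix
    have hz := hV x z
    rw [hfix, if_pos rfl] at hz
    have hsq := sq_sum_eq_sum_sq_add_two_mul x
    rw [hx1] at hsq
    have hle : (1 : ℝ) / 2 * ∑ i, ∑ j ∈ Finset.univ.filter (fun j => i < j), x i * x j ≤
        ∑ i, ∑ j ∈ Finset.univ.filter (fun j => i < j), p i j z * x i * x j := by
      simp only [Finset.mul_sum]
      refine Finset.sum_le_sum fun i _ => Finset.sum_le_sum fun j hj => ?_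
      rw [mul_assoc]
      exact mul_le_mul_of_nonneg_right (hhalf i j (Finset.mem_filter.mp hj).2)
        (mul_nonneg (hx i) (hx j))
    have hzsq : x z ^ 2 ≤ ∑ i, x i ^ 2 :=
      Finset.single_le_sum (f := fun i => x i ^ 2) (fun i _ => sq_nonneg _) (Finset.mem_univ z)
    have hxz : x z = 1 := by
      have : (x z - 1) ^ 2 = 0 := le_antisymm (by nlinarith) (sq_nonneg _)
      exact sub_eq_zero.mp (pow_eq_zero_iff two_ne_zero |>.mp this)
    funext k
    by_cases hk : k = z
    · simp [vertex, hk, hxz]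
    · have hrest : x z + ∑ i ∈ Finset.univ.erase z, x i = 1 := by
        rw [Finset.add_sum_erase _ _ (Finset.mem_univ z), hx1]
      have hxk : x k ≤ ∑ i ∈ Finset.univ.erase z, x i :=
        Finset.single_le_sum (fun i _ => hx i) (Finset.mem_erase.mpr ⟨hk, Finset.mem_univ k⟩)
      have hxk0 : x k = 0 := le_antisymm (by linarith) (hx k)
      simp [vertex, hk, hxk0]
end

section
/- Let V be a quadratic stochastic operator on S^{m-1} of the form (Vx)_1 = ∑_{i=1}^m x_i² + 2∑_{i<j} p_{ij,1} x_ix_j and (Vx)_k = 2∑_{i<j} p_{ij,k} x_ix_j for 2 ≤ k ≤ m, where p_{ij,1} ≥ 1/2 for all i < j. Then V is regular: for every x ∈ S^{m-1} the trajectory V^n x converges to the vertex e_1 as n → ∞. -/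
open Finset Filter Topology

/-- The square of a sum, split into its diagonal part and twice its upper triangular part. -/
theorem sum_sq_add_two_mul_sum_lt {m : ℕ} (x : Fin m → ℝ) :
    ∑ i, x i ^ 2 + 2 * ∑ i, ∑ j ∈ Finset.univ.filter (fun j => i < j), x i * x j =
      (∑ i, x i) ^ 2 := by
  have hsplit : ∀ i j : Fin m, x i * x j =
      (if i = j then x i * x j else 0) + (if i < j then x i * x j else 0) +
        (if j < i then x j * x i else 0) := by
    intro i j
    rcases lt_trichotomy i j with h | h | h
    · simp [h, h.ne, h.not_gt]
    · simp [h]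
    · simp [h, h.ne', h.not_gt, mul_comm]
  have hswap : ∑ i, ∑ j, (if j < i then x j * x i else 0) =
      ∑ i, ∑ j, (if i < j then x i * x j else 0) := Finset.sum_comm
  have hdiag : ∑ i, ∑ j, (if i = j then x i * x j else 0) = ∑ i, x i ^ 2 := by
    simp [sq]
  rw [sq (∑ i, x i), Finset.sum_mul_sum]
  simp_rw [Finset.sum_filter]
  rw [Finset.sum_congr rfl fun i _ => Finset.sum_congr rfl fun j _ => hsplit i j]
  simp_rw [Finset.sum_add_distrib]
  rw [hswap, hdiag]
  ring

/-- A nonnegative sequence with `s (n + 1) ≤ s n - s n ^ 2 / 2` starting in `[0, 1]` is bounded by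
`2 / (n + 2)`. -/
theorem le_two_div_of_quadratic_decrease {s : ℕ → ℝ} (h0 : s 0 ≤ 1)
    (hs : ∀ n, s (n + 1) ≤ s n - s n ^ 2 / 2) (n : ℕ) : s n ≤ 2 / (n + 2) := by
  induction n with
  | zero => simpa using h0
  | succ n ih =>
    have hn : (0 : ℝ) ≤ n := n.cast_nonneg
    set b : ℝ := 2 / (n + 2) with hb
    have hb1 : b ≤ 1 := by
      rw [hb, div_le_one (by positivity)]
      linarith
    have hmono : s n - s n ^ 2 / 2 ≤ b - b ^ 2 / 2 := by nlinarith
    have hstep : b - b ^ 2 / 2 ≤ 2 / ((n + 1 : ℕ) + 2) := by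
      have he : b - b ^ 2 / 2 = 2 * (n + 1) / (n + 2) ^ 2 := by
        rw [hb]
        field_simp
        ring
      rw [he, div_le_div_iff₀ (by positivity) (by positivity)]
      push_cast
      nlinarith
    exact (hs n).trans (hmono.trans hstep)

theorem InSimplex.le_one_sub {m : ℕ} {x : Fin m → ℝ} (hx : InSimplex x) {i k : Fin m}
    (h : i ≠ k) : x i ≤ 1 - x k := by
  have hle : ∑ j ∈ {i, k}, x j ≤ ∑ j, x j :=
    Finset.sum_le_sum_of_subset_of_nonneg (Finset.subset_univ _) fun j _ _ => hx.1 j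
  rw [Finset.sum_pair h, hx.2] at hle
  linarith

theorem InSimplex.le_one {m : ℕ} {x : Fin m → ℝ} (hx : InSimplex x) (k : Fin m) : x k ≤ 1 :=
  hx.2 ▸ Finset.single_le_sum (fun j _ => hx.1 j) (Finset.mem_univ k)

/-- A sequence in the simplex whose `k`-th coordinates tend to `1` tends to the `k`-th vertex. -/
theorem tendsto_vertex {m : ℕ} {u : ℕ → Fin m → ℝ} (hu : ∀ n, InSimplex (u n)) (k : Fin m)
    (h : Tendsto (fun n => 1 - u n k) atTop (𝓝 0)) : Tendsto u atTop (𝓝 (vertex k)) := by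
  rw [tendsto_pi_nhds]
  intro i
  by_cases hi : i = k
  · subst hi
    simpa [vertex] using h.const_sub 1
  · simp only [vertex, if_neg hi]
    exact squeeze_zero (fun n => (hu n).1 i) (fun n => (hu n).le_one_sub hi) h

section Operator

variable {m : ℕ} {k₀ : Fin m} {p : Fin m → Fin m → Fin m → ℝ} {x y : Fin m → ℝ}

theorem InSimplex.of_diagonal_absorbed (hnn : ∀ i j k, 0 ≤ p i j k)
    (hsum : ∀ i j : Fin m, i < j → ∑ k, p i j k = 1)
    (hy : ∀ k, y k = (if k = k₀ then ∑ i, x i ^ 2 else 0) +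
      2 * ∑ i, ∑ j ∈ Finset.univ.filter (fun j => i < j), p i j k * x i * x j)
    (hx : InSimplex x) : InSimplex y := by
  refine ⟨fun k => ?_, ?_⟩
  · rw [hy]
    have hoff : 0 ≤ ∑ i, ∑ j ∈ Finset.univ.filter (fun j => i < j), p i j k * x i * x j :=
      Finset.sum_nonneg fun i _ => Finset.sum_nonneg fun j _ =>
        mul_nonneg (mul_nonneg (hnn i j k) (hx.1 i)) (hx.1 j)
    have hdiag : 0 ≤ ∑ i, x i ^ 2 := Finset.sum_nonneg fun i _ => sq_nonneg _
    split_ifs <;> linarith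
  · have hoff : ∑ k, ∑ i, ∑ j ∈ Finset.univ.filter (fun j => i < j), p i j k * x i * x j =
        ∑ i, ∑ j ∈ Finset.univ.filter (fun j => i < j), x i * x j := by
      rw [Finset.sum_comm]
      refine Finset.sum_congr rfl fun i _ => ?_
      rw [Finset.sum_comm]
      refine Finset.sum_congr rfl fun j hj => ?_
      rw [← Finset.sum_mul, ← Finset.sum_mul, hsum i j (Finset.mem_filter.mp hj).2, one_mul]
    have hsq := sum_sq_add_two_mul_sum_lt x
    rw [hx.2, one_pow] at hsq
    simp_rw [hy]
    rw [Finset.sum_add_distrib, ← Finset.mul_sum, hoff]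
    simpa using hsq

theorem one_sub_le_of_half_le (hhalf : ∀ i j : Fin m, i < j → (1 : ℝ) / 2 ≤ p i j k₀)
    (hy : y k₀ = ∑ i, x i ^ 2 +
      2 * ∑ i, ∑ j ∈ Finset.univ.filter (fun j => i < j), p i j k₀ * x i * x j)
    (hx : InSimplex x) : 1 - y k₀ ≤ (1 - x k₀) - (1 - x k₀) ^ 2 / 2 := by
  have hoff : 1 / 2 * ∑ i, ∑ j ∈ Finset.univ.filter (fun j => i < j), x i * x j ≤
      ∑ i, ∑ j ∈ Finset.univ.filter (fun j => i < j), p i j k₀ * x i * x j := by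
    simp_rw [Finset.mul_sum]
    refine Finset.sum_le_sum fun i _ => Finset.sum_le_sum fun j hj => ?_
    rw [mul_assoc (p i j k₀)]
    exact mul_le_mul_of_nonneg_right (hhalf i j (Finset.mem_filter.mp hj).2)
      (mul_nonneg (hx.1 i) (hx.1 j))
  have hsq := sum_sq_add_two_mul_sum_lt x
  rw [hx.2, one_pow] at hsq
  have hk : x k₀ ^ 2 ≤ ∑ i, x i ^ 2 :=
    Finset.single_le_sum (f := fun i => x i ^ 2) (fun i _ => sq_nonneg _) (Finset.mem_univ k₀)
  linarith

end Operator

theorem stmt8 (m : ℕ) (hm : 0 < m) (p : Fin m → Fin m → Fin m → ℝ)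
    (hnn : ∀ i j k, 0 ≤ p i j k)
    (hsum : ∀ i j : Fin m, i < j → ∑ k, p i j k = 1)
    (hhalf : ∀ i j : Fin m, i < j → (1 : ℝ) / 2 ≤ p i j ⟨0, hm⟩)
    (V : (Fin m → ℝ) → Fin m → ℝ)
    (hV : ∀ x k, V x k =
      (if k = (⟨0, hm⟩ : Fin m) then ∑ i, x i ^ 2 else 0) +
        2 * ∑ i, ∑ j ∈ Finset.univ.filter (fun j => i < j), p i j k * x i * x j) :
    ∀ x, InSimplex x →
      Tendsto (fun n => V^[n] x) atTop (𝓝 (vertex (⟨0, hm⟩ : Fin m))) := by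
  intro x hx
  have hmem : ∀ n, InSimplex (V^[n] x) := by
    intro n
    induction n with
    | zero => exact hx
    | succ n ih =>
      rw [Function.iterate_succ_apply']
      exact ih.of_diagonal_absorbed hnn hsum (hV _)
  have hdecr : ∀ n, 1 - V^[n + 1] x ⟨0, hm⟩ ≤
      (1 - V^[n] x ⟨0, hm⟩) - (1 - V^[n] x ⟨0, hm⟩) ^ 2 / 2 := by
    intro n
    rw [Function.iterate_succ_apply']
    exact one_sub_le_of_half_le hhalf (by rw [hV, if_pos rfl]) (hmem n)
  have hlim : Tendsto (fun n : ℕ => (2 : ℝ) / (n + 2)) atTop (𝓝 0) :=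
    tendsto_const_nhds.div_atTop
      (tendsto_atTop_add_const_right _ _ tendsto_natCast_atTop_atTop)
  refine tendsto_vertex hmem _ (squeeze_zero (fun n => sub_nonneg.2 ((hmem n).le_one _)) ?_ hlim)
  exact le_two_div_of_quadratic_decrease (s := fun n => 1 - V^[n] x ⟨0, hm⟩)
    (sub_le_self _ (hx.1 _)) hdecr
end

section
/- Let V : S^{m-1} → S^{m-1} be a dissipative stochastic operator and x ∈ S^{m-1}. Then for each k = 1, …, m the sequence n ↦ ∑_{i=1}^k (V^n x)_{[i]} (the sum of the k largest coordinates of V^n x) is nondecreasing and bounded, hence convergent; consequently the decreasing rearrangement (V^n x)↓ converges to some point y ∈ S^{m-1} as n → ∞. -/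
open Finset Filter Topology

theorem sum_dsort {m : ℕ} (x : Fin m → ℝ) : ∑ i, dsort x i = ∑ i, x i :=
  Equiv.sum_comp (Fin.revPerm.trans (Tuple.sort x)) x

theorem InSimplex.dsort {m : ℕ} {x : Fin m → ℝ} (hx : InSimplex x) : InSimplex (dsort x) :=
  ⟨fun _ => hx.1 _, (sum_dsort x).trans hx.2⟩

theorem topSum_of_le {m : ℕ} (x : Fin m → ℝ) {k : ℕ} (hk : m ≤ k) :
    topSum x k = ∑ i, x i := by
  rw [topSum, Finset.filter_true_of_mem fun i _ => i.2.trans_le hk, sum_dsort]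

theorem InSimplex.topSum_le_one {m : ℕ} {x : Fin m → ℝ} (hx : InSimplex x) (k : ℕ) :
    topSum x k ≤ 1 := by
  rw [← hx.dsort.2]
  exact Finset.sum_le_sum_of_subset_of_nonneg (Finset.filter_subset _ _) fun i _ _ => hx.dsort.1 i

theorem Maj.topSum_le {m : ℕ} {x y : Fin m → ℝ} (h : Maj x y) (k : ℕ) :
    topSum x k ≤ topSum y k := by
  rcases Nat.eq_zero_or_pos k with rfl | hk
  · simp [topSum]
  rcases le_or_gt m k with hmk | hmk
  · rw [topSum_of_le x hmk, topSum_of_le y hmk, h.2]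
  · exact h.1 k hk (by omega)

theorem dsort_eq_topSum_sub {m : ℕ} (x : Fin m → ℝ) (i : Fin m) :
    dsort x i = topSum x (i + 1) - topSum x i := by
  have hset : Finset.univ.filter (fun j : Fin m => (j : ℕ) < i + 1) =
      insert i (Finset.univ.filter fun j : Fin m => (j : ℕ) < i) := by
    ext j
    simp only [Finset.mem_filter, Finset.mem_univ, true_and, Finset.mem_insert, Fin.ext_iff]
    omega
  rw [topSum, topSum, hset, Finset.sum_insert (by simp), add_sub_cancel_right]

theorem isClosed_setOf_inSimplex (m : ℕ) : IsClosed {x : Fin m → ℝ | InSimplex x} :=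
  isClosed_stdSimplex ℝ (Fin m)

theorem stmt14 (m : ℕ) (V : (Fin m → ℝ) → Fin m → ℝ)
    (hmap : ∀ x, InSimplex x → InSimplex (V x))
    (hdiss : ∀ x, InSimplex x → Maj x (V x))
    (x : Fin m → ℝ) (hx : InSimplex x) :
    (∀ k, Monotone (fun n => topSum (V^[n] x) k) ∧
      BddAbove (Set.range fun n => topSum (V^[n] x) k)) ∧
      ∃ y : Fin m → ℝ, InSimplex y ∧
        Tendsto (fun n => dsort (V^[n] x)) atTop (𝓝 y) := by
  have hmem (n : ℕ) : InSimplex (V^[n] x) := by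
    induction n with
    | zero => exact hx
    | succ n ih => rw [Function.iterate_succ_apply']; exact hmap _ ih
  have hmono (k : ℕ) : Monotone fun n => topSum (V^[n] x) k :=
    monotone_nat_of_le_succ fun n => by
      rw [Function.iterate_succ_apply']
      exact (hdiss _ (hmem n)).topSum_le k
  have hbdd (k : ℕ) : BddAbove (Set.range fun n => topSum (V^[n] x) k) :=
    ⟨1, Set.forall_mem_range.2 fun n => (hmem n).topSum_le_one k⟩
  have hlim : Tendsto (fun n => dsort (V^[n] x)) atTop
      (𝓝 fun i : Fin m => (⨆ n, topSum (V^[n] x) (i + 1)) - ⨆ n, topSum (V^[n] x) i) := by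
    refine tendsto_pi_nhds.2 fun i => ?_
    simp only [dsort_eq_topSum_sub]
    exact (tendsto_atTop_ciSup (hmono _) (hbdd _)).sub (tendsto_atTop_ciSup (hmono _) (hbdd _))
  exact ⟨fun k => ⟨hmono k, hbdd k⟩, _, (isClosed_setOf_inSimplex m).mem_of_tendsto hlim
    (Eventually.of_forall fun n => (hmem n).dsort), hlim⟩
end

section
/- Let V : S^{m-1} → S^{m-1} be a dissipative stochastic operator, x ∈ S^{m-1}, and let y ∈ S^{m-1} be the limit of the decreasing rearrangements (V^n x)↓ as n → ∞. Then every point z in the ω-limit set ω(x) satisfies z↓ = y; in particular ω(x) is a finite set of cardinality at most m!. -/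
open Finset Filter Topology

/-- A vector is the composition of its decreasing rearrangement with a permutation. -/
theorem exists_perm_dsort_comp {m : ℕ} (z : Fin m → ℝ) :
    ∃ τ : Equiv.Perm (Fin m), dsort z ∘ τ = z :=
  ⟨(Tuple.sort z).symm.trans Fin.revPerm, by ext i; simp [dsort]⟩

/-- The decreasing rearrangement has sequentially closed graph. -/
theorem dsort_eq_of_tendsto {m : ℕ} {u : ℕ → Fin m → ℝ} {z y : Fin m → ℝ}
    (hz : Tendsto u atTop (𝓝 z)) (hy : Tendsto (fun n => dsort (u n)) atTop (𝓝 y)) :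
    dsort z = y := by
  obtain ⟨σ, hσ⟩ : ∃ σ, ∃ᶠ n in atTop, Tuple.sort (u n) = σ := by
    by_contra! h
    obtain ⟨n, hn⟩ := (eventually_all.2 h).exists
    exact hn _ rfl
  let F : Filter ℕ := atTop ⊓ 𝓟 {n | Tuple.sort (u n) = σ}
  have : F.NeBot := frequently_mem_iff_neBot.1 hσ
  have hF : ∀ᶠ n in F, Tuple.sort (u n) = σ := mem_inf_of_right (mem_principal_self _)
  have hzF : ∀ i, Tendsto (fun n => u n i) F (𝓝 (z i)) := fun i =>
    (tendsto_pi_nhds.1 hz i).mono_left inf_le_left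
  have hmono : Monotone (z ∘ σ) := fun i j hij => by
    refine le_of_tendsto_of_tendsto (hzF (σ i)) (hzF (σ j)) ?_
    filter_upwards [hF] with n hn
    subst hn
    exact Tuple.monotone_sort (u n) hij
  have hsort : z ∘ σ = z ∘ Tuple.sort z := Tuple.comp_sort_eq_comp_iff_monotone.2 hmono
  ext i
  refine tendsto_nhds_unique ?_ ((tendsto_pi_nhds.1 hy i).mono_left (inf_le_left : F ≤ atTop))
  have hi : dsort z i = z (σ i.rev) := (congrFun hsort i.rev).symm
  rw [hi]
  refine (hzF (σ i.rev)).congr' ?_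
  filter_upwards [hF] with n hn
  rw [dsort, hn]


theorem stmt15 (m : ℕ) (V : (Fin m → ℝ) → Fin m → ℝ)
    (hmap : ∀ x, InSimplex x → InSimplex (V x))
    (hdiss : ∀ x, InSimplex x → Maj x (V x))
    (x : Fin m → ℝ) (hx : InSimplex x)
    (y : Fin m → ℝ) (hy : InSimplex y)
    (hconv : Tendsto (fun n => dsort (V^[n] x)) atTop (𝓝 y)) :
    (∀ z : Fin m → ℝ,
        (∃ φ : ℕ → ℕ, StrictMono φ ∧ Tendsto (fun j => V^[φ j] x) atTop (𝓝 z)) →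
        dsort z = y) ∧
      {z : Fin m → ℝ | ∃ φ : ℕ → ℕ, StrictMono φ ∧
        Tendsto (fun j => V^[φ j] x) atTop (𝓝 z)}.Finite ∧
      {z : Fin m → ℝ | ∃ φ : ℕ → ℕ, StrictMono φ ∧
        Tendsto (fun j => V^[φ j] x) atTop (𝓝 z)}.ncard ≤ m.factorial := by
  have key : ∀ z : Fin m → ℝ,
      (∃ φ : ℕ → ℕ, StrictMono φ ∧ Tendsto (fun j => V^[φ j] x) atTop (𝓝 z)) →
      dsort z = y := by
    rintro z ⟨φ, hφ, hz⟩
    exact dsort_eq_of_tendsto hz (hconv.comp hφ.tendsto_atTop)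
  have hsub : {z : Fin m → ℝ | ∃ φ : ℕ → ℕ, StrictMono φ ∧
      Tendsto (fun j => V^[φ j] x) atTop (𝓝 z)} ⊆
      (fun τ : Equiv.Perm (Fin m) => y ∘ τ) '' Set.univ := by
    intro z hz
    obtain ⟨τ, hτ⟩ := exists_perm_dsort_comp z
    exact ⟨τ, Set.mem_univ _, by rw [← key z hz]; exact hτ⟩
  refine ⟨key, (Set.toFinite _).subset hsub, ?_⟩
  calc _ ≤ ((fun τ : Equiv.Perm (Fin m) => y ∘ τ) '' Set.univ).ncard :=
        Set.ncard_le_ncard hsub (Set.toFinite _)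
    _ ≤ (Set.univ : Set (Equiv.Perm (Fin m))).ncard := Set.ncard_image_le (Set.toFinite _)
    _ = m.factorial := by
        rw [Set.ncard_univ, Nat.card_eq_fintype_card, Fintype.card_perm, Fintype.card_fin]
end
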